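/- Let H be an n-vertex C4-free Halin graph with characteristic tree T, and let (u, v, w) be a path in T such that v is a semi-branching vertex with d_T(v) = 3. If the bounded face of H incident to the path (u, v, w) has size at least 6, then there exists an (n−2)-vertex C4-free Halin graph H′ such that e(H) = e(H′) + 3. -/

import Mathlib

open SimpleGraph

/-- Degree of a vertex as the `ncard` of its neighbour set. -/
noncomputable def ncDeg {V : Type*} (G : SimpleGraph V) (v : V) : ℕ :=
  (G.neighborSet v).ncard

/-- A leaf is a vertex of degree one. -/
def IsLeaf {V : Type*} (G : SimpleGraph V) (v : V) : Prop :=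
  ncDeg G v = 1

/-- A Halin graph, presented by its characteristic tree `T` and outer cycle `C`.
The underlying graph is `T ⊔ C`.  The outer cycle is a `2`-regular connected graph
whose support is exactly the set of leaves of `T`, every non-leaf of `T` has degree
at least three, and the cycle is compatible with a planar embedding: for every edge
`uv` of `T`, the leaves lying in each component of `T - uv` are consecutive on the
cycle, i.e. they induce a connected subgraph of the cycle. -/
structure HalinGraph (V : Type*) [Fintype V] : Type _ where
  /-- the characteristic tree -/
  T : SimpleGraph V
  /-- the outer cycle -/
  C : SimpleGraph V
  tree_isTree : T.IsTree
  four_le_card : 4 ≤ Fintype.card V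
  nonleaf_degree : ∀ v : V, ¬ IsLeaf T v → 3 ≤ ncDeg T v
  support_C : C.support = {v : V | IsLeaf T v}
  two_regular : ∀ v ∈ C.support, ncDeg C v = 2
  cycle_connected : (C.induce C.support).Connected
  planar : ∀ u v : V, T.Adj u v →
    (C.induce {x : V | IsLeaf T x ∧ (T.deleteEdges {s(u, v)}).Reachable u x}).Connected

/-- The Halin graph itself: the (edge-disjoint) union of the tree and the outer cycle. -/
def HalinGraph.graph {V : Type*} [Fintype V] (H : HalinGraph V) : SimpleGraph V :=
  H.T ⊔ H.C

/-- Number of edges of a graph. -/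
noncomputable def eCount {V : Type*} (G : SimpleGraph V) : ℕ :=
  G.edgeSet.ncard

/-- A graph is `C₄`-free iff it contains no cycle of length `4`. -/
def C4Free {V : Type*} (G : SimpleGraph V) : Prop :=
  ∀ (v : V) (w : G.Walk v v), w.IsCycle → w.length ≠ 4

/-- A semi-branching vertex of the characteristic tree: a non-leaf with at least one
leaf neighbour and at least two non-leaf neighbours. -/
def SemiBranching {V : Type*} (T : SimpleGraph V) (v : V) : Prop :=
  ¬ IsLeaf T v ∧ (∃ x, T.Adj v x ∧ IsLeaf T x) ∧
    ∃ x y : V, x ≠ y ∧ T.Adj v x ∧ T.Adj v y ∧ ¬ IsLeaf T x ∧ ¬ IsLeaf T y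

/-- The vertices on the `p`-side of the edge `pq`. -/
def Side {V : Type*} (T : SimpleGraph V) (p q : V) : Set V :=
  {z | (T.deleteEdges {s(p, q)}).Reachable p z}

/-- Connectivity of the subgraph of `C` induced on `S`, phrased without subtypes. -/
def ConnOn {V : Type*} (C : SimpleGraph V) (S : Set V) : Prop :=
  S.Nonempty ∧ ∀ s ∈ S, ∀ t ∈ S,
    Relation.ReflTransGen (fun s t => C.Adj s t ∧ s ∈ S ∧ t ∈ S) s t

section Reachability

variable {V W : Type*}

theorem reachable_invariant {G : SimpleGraph V} {P : V → Prop} {s t : V} (hs : P s)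
    (step : ∀ s t, P s → G.Adj s t → P t) (h : G.Reachable s t) : P t := by
  rw [SimpleGraph.reachable_iff_reflTransGen] at h
  induction h with
  | refl => exact hs
  | tail _ hadj ih => exact step _ _ ih hadj

theorem reachable_map_of_adj {G : SimpleGraph V} {G' : SimpleGraph W} (f : V → W)
    (h : ∀ s t, G.Adj s t → G'.Reachable (f s) (f t)) {s t : V} (hst : G.Reachable s t) :
    G'.Reachable (f s) (f t) :=
  reachable_invariant (P := fun z => G'.Reachable (f s) (f z)) (Reachable.refl _)
    (fun _ _ hp hadj => hp.trans (h _ _ hadj)) hst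

theorem connected_induce_iff_connOn (C : SimpleGraph V) (S : Set V) :
    (C.induce S).Connected ↔ ConnOn C S := by
  constructor
  · intro h
    obtain ⟨s⟩ := h.nonempty
    refine ⟨⟨s, s.2⟩, fun s hs t ht => ?_⟩
    exact reachable_invariant (G := C.induce S)
      (P := fun z => Relation.ReflTransGen (fun s t => C.Adj s t ∧ s ∈ S ∧ t ∈ S) s z.1)
      (s := ⟨s, hs⟩) (t := ⟨t, ht⟩) Relation.ReflTransGen.refl
      (fun p q hp hpq => hp.tail ⟨hpq, p.2, q.2⟩) (h.preconnected _ _)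
  · rintro ⟨⟨s, hs⟩, h⟩
    have : Nonempty S := ⟨⟨s, hs⟩⟩
    refine ⟨fun p q => ?_⟩
    have key : ∀ z, Relation.ReflTransGen (fun s t => C.Adj s t ∧ s ∈ S ∧ t ∈ S) p.1 z →
        ∀ hz : z ∈ S, (C.induce S).Reachable p ⟨z, hz⟩ := by
      intro z hz
      induction hz with
      | refl => intro _; exact Reachable.refl _
      | tail _ hadj ih =>
        intro hz
        refine (ih hadj.2.1).trans (Adj.reachable ?_)
        exact hadj.1
    exact key q.1 (h _ p.2 _ q.2) q.2

/-- A map along which edges inside `S` become walks inside `S'` transports connectivity. -/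
theorem ConnOn.map {C : SimpleGraph V} {C' : SimpleGraph W} {S : Set V} {S' : Set W}
    (h : ConnOn C S) (f : V → W) (hne : S'.Nonempty) (hsurj : ∀ z ∈ S', ∃ s ∈ S, f s = z)
    (hadj : ∀ s ∈ S, ∀ t ∈ S, C.Adj s t →
      Relation.ReflTransGen (fun s t => C'.Adj s t ∧ s ∈ S' ∧ t ∈ S') (f s) (f t)) :
    ConnOn C' S' := by
  refine ⟨hne, fun p hp q hq => ?_⟩
  obtain ⟨s, hs, rfl⟩ := hsurj p hp
  obtain ⟨t, ht, rfl⟩ := hsurj q hq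
  have := h.2 s hs t ht
  clear hq ht
  induction this with
  | refl => exact Relation.ReflTransGen.refl
  | tail _ h1 ih => exact ih.trans (hadj _ h1.2.1 _ h1.2.2 h1.1)

/-- If no edge leaves `P` inside `S`, a connected `S` meeting `P` lies inside `P`. -/
theorem ConnOn.invariant {C : SimpleGraph V} {S : Set V} (h : ConnOn C S) {P : V → Prop} {s : V}
    (hs : s ∈ S) (hPs : P s) (step : ∀ p ∈ S, ∀ q ∈ S, P p → C.Adj p q → P q) :
    ∀ t ∈ S, P t := by
  intro t ht
  have := h.2 s hs t ht
  clear ht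
  induction this with
  | refl => exact hPs
  | tail _ h1 ih => exact step _ h1.2.1 _ h1.2.2 ih h1.1

end Reachability

section Sides

variable {V : Type*} {T : SimpleGraph V}

theorem mem_side_self (p q : V) : p ∈ Side T p q := Reachable.refl _

theorem side_step {p q s t : V} (hs : s ∈ Side T p q) (h : T.Adj s t)
    (hne : s(s, t) ≠ s(p, q)) : t ∈ Side T p q := by
  refine Reachable.trans hs (Adj.reachable ?_)
  rw [SimpleGraph.deleteEdges_adj]
  exact ⟨h, hne⟩

theorem side_induction {p q : V} {P : V → Prop} (hp : P p)
    (step : ∀ s t, s ∈ Side T p q → P s → T.Adj s t → s(s, t) ≠ s(p, q) → P t) :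
    ∀ t ∈ Side T p q, P t := by
  intro t ht
  refine (reachable_invariant (P := fun z => z ∈ Side T p q ∧ P z)
    ⟨mem_side_self _ _, hp⟩ ?_ ht).2
  rintro s t ⟨hs, hPs⟩ hadj
  rw [SimpleGraph.deleteEdges_adj] at hadj
  exact ⟨side_step hs hadj.1 hadj.2, step s t hs hPs hadj.1 hadj.2⟩

theorem notMem_side (hT : T.IsTree) {p q : V} (h : T.Adj p q) : q ∉ Side T p q :=
  (SimpleGraph.isBridge_iff.1 (SimpleGraph.isAcyclic_iff_forall_adj_isBridge.1 hT.isAcyclic h))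

theorem side_closed (hT : T.IsTree) {p q s t : V} (h : T.Adj p q) (hs : s ∈ Side T p q)
    (hst : T.Adj s t) : t ∈ Side T p q ∨ (s = p ∧ t = q) := by
  by_cases hne : s(s, t) = s(p, q)
  · rw [Sym2.eq_iff] at hne
    rcases hne with hne | ⟨rfl, rfl⟩
    · exact Or.inr hne
    · exact absurd hs (notMem_side hT h)
  · exact Or.inl (side_step hs hst hne)

theorem side_disjoint (hT : T.IsTree) {p q z : V} (h : T.Adj p q) (hz : z ∈ Side T p q) :
    z ∉ Side T q p := by
  intro hz'
  have h1 : (T.deleteEdges {s(p, q)}).Reachable q z := by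
    have : s(q, p) = s(p, q) := Sym2.eq_swap
    simpa [Side, this] using hz'
  exact notMem_side hT h (Reachable.trans hz h1.symm)

theorem side_cover (hT : T.IsTree) {p q : V} (h : T.Adj p q) (z : V) :
    z ∈ Side T p q ∨ z ∈ Side T q p := by
  refine reachable_invariant (P := fun z => z ∈ Side T p q ∨ z ∈ Side T q p)
    (Or.inl (mem_side_self p q)) ?_ (hT.connected.preconnected p z)
  rintro s t (hs | hs) hst
  · rcases side_closed hT h hs hst with h1 | ⟨-, rfl⟩
    · exact Or.inl h1
    · exact Or.inr (mem_side_self _ _)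
  · rcases side_closed hT h.symm hs hst with h1 | ⟨-, rfl⟩
    · exact Or.inr h1
    · exact Or.inl (mem_side_self _ _)

theorem mem_side_iff_notMem (hT : T.IsTree) {p q z : V} (h : T.Adj p q) :
    z ∈ Side T p q ↔ z ∉ Side T q p :=
  ⟨side_disjoint hT h, fun h1 => (side_cover hT h z).resolve_right h1⟩

/-- The branch behind `r` at `q` lies on the `q`-side of any other edge `qp`. -/
theorem side_subset (hT : T.IsTree) {p q r : V} (hqr : T.Adj q r) (hrp : r ≠ p) :
    Side T r q ⊆ Side T q p := by
  refine side_induction (side_step (mem_side_self _ _) hqr ?_) ?_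
  · simp only [ne_eq, Sym2.eq_iff]; rintro (⟨-, h⟩ | ⟨-, h⟩)
    · exact hrp h
    · exact hqr.ne h.symm
  · intro s t hs hP hst hne
    refine side_step hP hst fun he => ?_
    have hq := notMem_side hT hqr.symm
    have ht := side_step hs hst hne
    rw [Sym2.eq_iff] at he
    rcases he with ⟨rfl, -⟩ | ⟨-, rfl⟩
    · exact hq hs
    · exact hq ht

theorem branches_disjoint (hT : T.IsTree) {q r r' z : V} (h : T.Adj q r) (h' : T.Adj q r')
    (hne : r ≠ r') (hz : z ∈ Side T r q) : z ∉ Side T r' q :=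
  fun hz' => side_disjoint hT h.symm hz (side_subset hT h' hne.symm hz')

end Sides

section Leaves

theorem IsLeaf.eq_of_adj {V : Type*} {T : SimpleGraph V} {x p q : V} (hx : IsLeaf T x)
    (hp : T.Adj x p) (hq : T.Adj x q) :
    p = q := by
  obtain ⟨a, ha⟩ := Set.ncard_eq_one.1 hx
  have h1 : p ∈ T.neighborSet x := hp
  have h2 : q ∈ T.neighborSet x := hq
  rw [ha] at h1 h2
  exact h1.trans h2.symm

variable {V : Type*} [Fintype V] {T : SimpleGraph V}

theorem exists_two_other_neighbors {p q : V} (h : 3 ≤ ncDeg T q) :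
    ∃ r r', r ≠ r' ∧ r ≠ p ∧ r' ≠ p ∧ T.Adj q r ∧ T.Adj q r' := by
  have h1 : 1 < (T.neighborSet q \ {p}).ncard := by
    have := Set.ncard_le_ncard_sdiff_add_ncard (T.neighborSet q) {p} (Set.toFinite _)
    rw [Set.ncard_singleton] at this
    unfold ncDeg at h
    omega
  obtain ⟨r, hr, r', hr', hne⟩ := (Set.one_lt_ncard (Set.toFinite _)).1 h1
  exact ⟨r, r', hne, hr.2, hr'.2, hr.1, hr'.1⟩

theorem exists_leaf_mem_side (hT : T.IsTree) (hdeg : ∀ z, ¬ IsLeaf T z → 3 ≤ ncDeg T z)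
    {p q : V} (h : T.Adj p q) : ∃ z ∈ Side T q p, IsLeaf T z := by
  induction hn : (Side T q p).ncard using Nat.strong_induction_on generalizing p q with
  | _ n ih =>
    by_cases hq : IsLeaf T q
    · exact ⟨q, mem_side_self _ _, hq⟩
    · obtain ⟨r, -, -, hrp, -, hqr, -⟩ := exists_two_other_neighbors (p := p) (hdeg q hq)
      have hsub := side_subset hT hqr hrp
      have hlt : (Side T r q).ncard < (Side T q p).ncard :=
        Set.ncard_lt_ncard (LE.le.ssubset_of_mem_notMem hsub (mem_side_self _ _)
          (notMem_side hT hqr.symm)) (Set.toFinite _)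
      obtain ⟨z, hz, hl⟩ := ih _ (hn ▸ hlt) hqr rfl
      exact ⟨z, hsub hz, hl⟩

theorem exists_two_leaves_mem_side (hT : T.IsTree) (hdeg : ∀ z, ¬ IsLeaf T z → 3 ≤ ncDeg T z)
    {p q : V} (hq : ¬ IsLeaf T q) :
    ∃ z z', z ≠ z' ∧ z ∈ Side T q p ∧ z' ∈ Side T q p ∧ IsLeaf T z ∧ IsLeaf T z' := by
  obtain ⟨r, r', hne, hrp, hrp', hqr, hqr'⟩ := exists_two_other_neighbors (p := p) (hdeg q hq)
  obtain ⟨z, hz, hl⟩ := exists_leaf_mem_side hT hdeg hqr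
  obtain ⟨z', hz', hl'⟩ := exists_leaf_mem_side hT hdeg hqr'
  refine ⟨z, z', ?_, side_subset hT hqr hrp hz, side_subset hT hqr' hrp' hz', hl, hl'⟩
  rintro rfl
  exact branches_disjoint hT hqr hqr' hne hz hz'

theorem HalinGraph.not_adj_of_isLeaf (H : HalinGraph V) {p q : V} (hp : IsLeaf H.T p)
    (hq : IsLeaf H.T q) : ¬ H.T.Adj p q := by
  classical
  intro h
  have hall : ∀ z, z ∈ ({p, q} : Finset V) := fun z => by
    refine reachable_invariant (P := fun z => z ∈ ({p, q} : Finset V)) (by simp) ?_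
      (H.tree_isTree.connected.preconnected p z)
    intro s t hs hst
    simp only [Finset.mem_insert, Finset.mem_singleton] at hs ⊢
    rcases hs with rfl | rfl
    · exact Or.inr (hp.eq_of_adj hst h)
    · exact Or.inl (hq.eq_of_adj hst h.symm)
  have h1 := Finset.card_le_card (fun z _ => hall z : (Finset.univ : Finset V) ⊆ _)
  have h2 := Finset.card_le_two (a := p) (b := q)
  have := H.four_le_card
  rw [Finset.card_univ] at h1
  omega

theorem HalinGraph.isLeaf_of_adj (H : HalinGraph V) {p q : V} (h : H.C.Adj p q) :
    IsLeaf H.T p := by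
  have : p ∈ H.C.support := ⟨q, h⟩
  rwa [H.support_C] at this

theorem HalinGraph.eCount_graph (H : HalinGraph V) :
    eCount H.graph + 1 = Fintype.card V + {z | IsLeaf H.T z}.ncard := by
  classical
  have hdisj : Disjoint H.T.edgeSet H.C.edgeSet := by
    rw [Set.disjoint_left]
    intro e
    induction e with
    | _ p q =>
      intro h1 h2
      exact H.not_adj_of_isLeaf (H.isLeaf_of_adj h2) (H.isLeaf_of_adj (Adj.symm h2)) h1
  have hT : H.T.edgeSet.ncard + 1 = Fintype.card V := by
    rw [← H.tree_isTree.card_edgeFinset, Set.ncard_eq_toFinset_card']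
    rfl
  have hC : H.C.edgeSet.ncard = {z | IsLeaf H.T z}.ncard := by
    have h1 := H.C.sum_degrees_eq_twice_card_edges
    have h2 : ∀ z, H.C.degree z = if IsLeaf H.T z then 2 else 0 := by
      intro z
      have hz : H.C.degree z = ncDeg H.C z := by
        rw [ncDeg, Set.ncard_eq_toFinset_card', ← SimpleGraph.card_neighborSet_eq_degree,
          Set.toFinset_card]
      split_ifs with hl
      · rw [hz]
        apply H.two_regular
        rw [H.support_C]; exact hl
      · rw [SimpleGraph.degree_eq_zero_iff_notMem_support, H.support_C]; exact hl
    simp only [h2, Finset.sum_ite, Finset.sum_const, smul_eq_mul] at h1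
    have h3 : {z | IsLeaf H.T z}.ncard = (Finset.univ.filter fun z => IsLeaf H.T z).card := by
      rw [Set.ncard_eq_toFinset_card']; congr 1; ext; simp
    have h4 : H.C.edgeSet.ncard = H.C.edgeFinset.card := by
      rw [Set.ncard_eq_toFinset_card']; rfl
    omega
  rw [eCount, HalinGraph.graph, SimpleGraph.edgeSet_sup,
    Set.ncard_union_eq hdisj (Set.toFinite _) (Set.toFinite _), hC]
  omega

end Leaves

/-- `C₄`-freeness in terms of four vertices. -/
theorem c4Free_iff {V : Type*} (G : SimpleGraph V) :
    C4Free G ↔ ∀ p q r s, G.Adj p q → G.Adj q r → G.Adj r s → G.Adj s p → p ≠ r → q = s := by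
  constructor
  · intro h p q r s h1 h2 h3 h4 hpr
    by_contra hqs
    refine h p (.cons h1 (.cons h2 (.cons h3 (.cons h4 .nil)))) ?_ rfl
    rw [SimpleGraph.Walk.isCycle_def, SimpleGraph.Walk.isTrail_def]
    have := h1.ne; have := h2.ne; have := h3.ne; have := h4.ne
    refine ⟨?_, by simp, ?_⟩
    · simp; grind
    · simp; grind
  · intro h p c hc hl
    cases c with
    | nil => simp at hl
    | cons h1 c => cases c with
      | nil => simp at hl
      | cons h2 c => cases c with
        | nil => simp at hl
        | cons h3 c => cases c with
          | nil => simp at hl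
          | cons h4 c => cases c with
            | cons h5 c => simp at hl
            | nil =>
              have h5 := hc.support_nodup
              simp at h5
              have := h _ _ _ _ h1 h2 h3 h4
              grind

/-- A connected piece of a cycle has at most two outgoing edges. -/
theorem ConnOn.card_boundary_le {V : Type*} [Fintype V] {C : SimpleGraph V} {S : Set V}
    (h : ConnOn C S) (hreg : ∀ z ∈ S, ncDeg C z = 2) :
    {e : V × V | e.1 ∈ S ∧ e.2 ∉ S ∧ C.Adj e.1 e.2}.ncard ≤ 2 := by
  classical
  have hconn := (connected_induce_iff_connOn C S).2 h
  have h1 := hconn.card_vert_le_card_edgeSet_add_one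
  have h2 := (C.induce S).sum_degrees_eq_twice_card_edges
  have h3 : ∀ z : S, (C.induce S).degree z +
      (Finset.univ.filter fun t => C.Adj z t ∧ t ∉ S).card = 2 := by
    intro z
    rw [← hreg z z.2, ncDeg, Set.ncard_eq_toFinset_card']
    have e1 : (C.induce S).degree z =
        (Finset.univ.filter fun t => C.Adj z t ∧ t ∈ S).card := by
      rw [← SimpleGraph.card_neighborFinset_eq_degree,
        ← Finset.card_map (Function.Embedding.subtype (· ∈ S))]
      congr 1
      ext t
      simp
    rw [e1, ← Finset.card_union_of_disjoint]
    · congr 1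
      ext t; simp; tauto
    · rw [Finset.disjoint_left]; intro t; simp; tauto
  have h4 : {e : V × V | e.1 ∈ S ∧ e.2 ∉ S ∧ C.Adj e.1 e.2}.ncard =
      ∑ z : S, (Finset.univ.filter fun t => C.Adj z t ∧ t ∉ S).card := by
    rw [← Finset.card_sigma, Set.ncard_eq_toFinset_card']
    symm
    refine Finset.card_bij (fun e _ => (e.1.1, e.2)) ?_ ?_ ?_
    · rintro ⟨s, t⟩; simp; tauto
    · rintro ⟨⟨s, hs⟩, t⟩ - ⟨⟨s', hs'⟩, t'⟩ -; simp
    · rintro ⟨s, t⟩ hst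
      simp at hst
      exact ⟨⟨⟨s, hst.1⟩, t⟩, by simp; tauto, rfl⟩
  have h5 := Finset.sum_congr (rfl : (Finset.univ : Finset S) = _) (fun z _ => h3 z)
  rw [Finset.sum_add_distrib, h2, ← h4] at h5
  simp only [Finset.sum_const, smul_eq_mul, Finset.card_univ] at h5
  rw [Nat.card_eq_fintype_card, Nat.card_eq_fintype_card, ← SimpleGraph.edgeFinset_card] at h1
  omega

/-- Delete `v` and `x` from the tree and join `y` to `w`; the deleted vertices become isolated. -/
def splicedTree {V : Type*} (T : SimpleGraph V) (v x y w : V) : SimpleGraph V where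
  Adj s t := s ≠ t ∧ (s ≠ v ∧ s ≠ x ∧ t ≠ v ∧ t ≠ x) ∧
    (T.Adj s t ∨ (s = y ∧ t = w) ∨ (s = w ∧ t = y))
  symm := ⟨fun s t h => by have := T.adj_comm s t; tauto⟩
  loopless := ⟨fun s h => h.1 rfl⟩

/-- Delete `x` and the edge `cd` from the cycle and insert the edges `ad` and `bc`. -/
def splicedCycle {V : Type*} (C : SimpleGraph V) (x a b c d : V) : SimpleGraph V where
  Adj s t := s ≠ t ∧ (s ≠ x ∧ t ≠ x) ∧
    ((C.Adj s t ∧ ¬ (s = c ∧ t = d) ∧ ¬ (s = d ∧ t = c)) ∨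
      (s = a ∧ t = d) ∨ (s = d ∧ t = a) ∨ (s = b ∧ t = c) ∨ (s = c ∧ t = b))
  symm := ⟨fun s t h => by have := C.adj_comm s t; tauto⟩
  loopless := ⟨fun s h => h.1 rfl⟩

theorem splicedTree_swap {V : Type*} (T : SimpleGraph V) (v x y w : V) :
    splicedTree T v x w y = splicedTree T v x y w := by
  ext s t; simp only [splicedTree]; tauto

theorem splicedCycle_swap {V : Type*} (C : SimpleGraph V) (x a b c d : V) :
    splicedCycle C x b a d c = splicedCycle C x a b c d := by
  ext s t; simp only [splicedCycle]; tauto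

/-- A degree-three vertex `v` with leaf neighbour `x` and branches `A` (rooted at `y`) and `B`
(rooted at `w`). -/
structure Branches {V : Type*} (T : SimpleGraph V) (v x y w : V) (A B : Set V) : Prop where
  isTree : T.IsTree
  eq_A : A = Side T y v
  eq_B : B = Side T w v
  adj_v : ∀ t, T.Adj v t ↔ t = x ∨ t = y ∨ t = w
  adj_x : ∀ t, T.Adj x t ↔ t = v
  x_ne_y : x ≠ y
  x_ne_w : x ≠ w
  y_ne_w : y ≠ w
  leaf_x : IsLeaf T x
  leaf_v : ¬ IsLeaf T v
  leaf_y : ¬ IsLeaf T y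
  leaf_w : ¬ IsLeaf T w
  leaf_adj : ∀ s t, IsLeaf T s → IsLeaf T t → ¬ T.Adj s t

/-- The cycle around a pair of branches: the leaf `x` lies between `a ∈ A` and `b ∈ B`, and `cd`
is the other edge joining the two branches. -/
structure Surgery {V : Type*} (T C : SimpleGraph V) (v x y w a b c d : V) (A B : Set V) : Prop
    extends Branches T v x y w A B where
  a_mem : a ∈ A
  b_mem : b ∈ B
  c_mem : c ∈ A
  d_mem : d ∈ B
  isLeaf_of_adj : ∀ s t, C.Adj s t → IsLeaf T s
  cycle_adj_x : ∀ t, C.Adj x t ↔ t = a ∨ t = b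
  cross : ∀ s ∈ A, ∀ t ∈ B, C.Adj s t ↔ s = c ∧ t = d
  a_ne_c : a ≠ c
  b_ne_d : b ≠ d
  not_adj_ay : ¬ T.Adj a y
  not_adj_bw : ¬ T.Adj b w
  not_adj_ac : ¬ C.Adj a c
  not_adj_bd : ¬ C.Adj b d
  connA : ConnOn C {z | IsLeaf T z ∧ z ∈ A}
  connB : ConnOn C {z | IsLeaf T z ∧ z ∈ B}

namespace Branches

variable {V : Type*} {T : SimpleGraph V} {v x y w : V} {A B : Set V}

theorem swap (h : Branches T v x y w A B) : Branches T v x w y B A where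
  isTree := h.isTree
  eq_A := h.eq_B
  eq_B := h.eq_A
  adj_v t := by rw [h.adj_v]; tauto
  adj_x := h.adj_x
  x_ne_y := h.x_ne_w
  x_ne_w := h.x_ne_y
  y_ne_w := h.y_ne_w.symm
  leaf_x := h.leaf_x
  leaf_v := h.leaf_v
  leaf_y := h.leaf_w
  leaf_w := h.leaf_y
  leaf_adj := h.leaf_adj

theorem adj_vx (h : Branches T v x y w A B) : T.Adj v x := (h.adj_v x).2 (Or.inl rfl)

theorem adj_vy (h : Branches T v x y w A B) : T.Adj v y :=
  (h.adj_v y).2 (Or.inr (Or.inl rfl))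

theorem adj_vw (h : Branches T v x y w A B) : T.Adj v w := h.swap.adj_vy

theorem y_mem (h : Branches T v x y w A B) : y ∈ A := h.eq_A ▸ mem_side_self _ _

theorem w_mem (h : Branches T v x y w A B) : w ∈ B := h.swap.y_mem

theorem closed (h : Branches T v x y w A B) {s t : V} (hs : s ∈ A) (hst : T.Adj s t) :
    t ∈ A ∨ (s = y ∧ t = v) := by
  have := h.eq_A
  subst this
  exact side_closed h.isTree h.adj_vy.symm hs hst

theorem v_notMem (h : Branches T v x y w A B) : v ∉ A := by
  rw [h.eq_A]; exact notMem_side h.isTree h.adj_vy.symm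

theorem x_notMem (h : Branches T v x y w A B) : x ∉ A := fun hx => by
  rcases h.closed hx h.adj_vx.symm with h1 | ⟨h1, -⟩
  · exact h.v_notMem h1
  · exact h.x_ne_y h1

theorem disjoint (h : Branches T v x y w A B) {z : V} (hA : z ∈ A) : z ∉ B := by
  rw [h.eq_A] at hA
  rw [h.eq_B]
  exact branches_disjoint h.isTree h.adj_vy h.adj_vw h.y_ne_w hA

theorem cover (h : Branches T v x y w A B) (z : V) :
    z = v ∨ z = x ∨ z ∈ A ∨ z ∈ B := by
  refine reachable_invariant (P := fun z => z = v ∨ z = x ∨ z ∈ A ∨ z ∈ B) (Or.inl rfl) ?_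
    (h.isTree.connected.preconnected v z)
  rintro s t (rfl | rfl | hs | hs) hst
  · rcases (h.adj_v t).1 hst with rfl | rfl | rfl
    · simp
    · simp [h.y_mem]
    · simp [h.w_mem]
  · simp [(h.adj_x t).1 hst]
  · have := h.closed hs hst; tauto
  · have := h.swap.closed hs hst; tauto

theorem ne_of_mem (h : Branches T v x y w A B) {z : V} (hz : z ∈ A) :
    z ≠ v ∧ z ≠ x :=
  ⟨fun e => h.v_notMem (e ▸ hz), fun e => h.x_notMem (e ▸ hz)⟩

theorem not_adj_AB (h : Branches T v x y w A B) {s t : V} (hs : s ∈ A) (ht : t ∈ B) :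
    ¬ T.Adj s t := fun hst => by
  rcases h.closed hs hst with h1 | ⟨-, h1⟩
  · exact h.disjoint h1 ht
  · exact h.swap.v_notMem (h1 ▸ ht)

theorem mem_of_isLeaf (h : Branches T v x y w A B) {s : V} (hs : IsLeaf T s)
    (hx : s ≠ x) : s ∈ A ∨ s ∈ B := by
  have := h.cover s
  have : s ≠ v := fun e => h.leaf_v (e ▸ hs)
  tauto

/-- An edge inside the branch `A` has everything outside `A` on the same side as `v`. -/
theorem compl_subset_side (h : Branches T v x y w A B) {p q : V} (hp : p ∈ A) (hq : q ∈ A)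
    (hv : v ∈ Side T p q) {z : V} (hz : z ∉ A) : z ∈ Side T p q := by
  have hne : ∀ s t, s ∉ A → s(s, t) ≠ s(p, q) := by
    intro s t hs; rw [Ne, Sym2.eq_iff]; grind
  have hw : w ∈ Side T p q := side_step hv h.adj_vw (hne _ _ h.v_notMem)
  rcases h.cover z with rfl | rfl | h1 | h1
  · exact hv
  · exact side_step hv h.adj_vx (hne _ _ h.v_notMem)
  · exact absurd h1 hz
  · rw [h.eq_B] at h1
    refine side_induction (P := fun z => z ∈ Side T p q) hw ?_ z h1
    intro s t hs hP hst _
    rw [← h.eq_B] at hs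
    exact side_step hP hst (hne _ _ (h.swap.disjoint hs))

end Branches

namespace Surgery

variable {V : Type*} {T C : SimpleGraph V} {v x y w a b c d : V} {A B : Set V}

theorem swap (h : Surgery T C v x y w a b c d A B) : Surgery T C v x w y b a d c B A where
  toBranches := h.toBranches.swap
  a_mem := h.b_mem
  b_mem := h.a_mem
  c_mem := h.d_mem
  d_mem := h.c_mem
  isLeaf_of_adj := h.isLeaf_of_adj
  cycle_adj_x t := by rw [h.cycle_adj_x]; tauto
  cross s hs t ht := by rw [C.adj_comm, h.cross t ht s hs]; tauto
  a_ne_c := h.b_ne_d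
  b_ne_d := h.a_ne_c
  not_adj_ay := h.not_adj_bw
  not_adj_bw := h.not_adj_ay
  not_adj_ac := h.not_adj_bd
  not_adj_bd := h.not_adj_ac
  connA := h.connB
  connB := h.connA

theorem adj_cd (h : Surgery T C v x y w a b c d A B) : C.Adj c d :=
  (h.cross c h.c_mem d h.d_mem).2 ⟨rfl, rfl⟩

/-! ### Adjacency in the new graphs -/

theorem tree_adj_same (h : Surgery T C v x y w a b c d A B) {s t : V} (hs : s ∈ A) (ht : t ∈ A)
    (hst : (splicedTree T v x y w).Adj s t) : T.Adj s t := by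
  obtain ⟨-, -, h1 | ⟨-, rfl⟩ | ⟨rfl, -⟩⟩ := hst
  · exact h1
  · exact absurd h.w_mem (h.disjoint ht)
  · exact absurd h.w_mem (h.disjoint hs)

theorem tree_adj_cross (h : Surgery T C v x y w a b c d A B) {s t : V} (hs : s ∈ A)
    (ht : t ∈ B) (hst : (splicedTree T v x y w).Adj s t) : s = y ∧ t = w := by
  obtain ⟨-, -, h1 | h1 | ⟨rfl, -⟩⟩ := hst
  · exact absurd h1 (h.not_adj_AB hs ht)
  · exact h1
  · exact absurd h.w_mem (h.disjoint hs)

theorem cycle_adj_same (h : Surgery T C v x y w a b c d A B) {s t : V} (hs : s ∈ A)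
    (ht : t ∈ A) : (splicedCycle C x a b c d).Adj s t ↔ C.Adj s t := by
  have h1 := h.disjoint hs
  have h2 := h.disjoint ht
  have h3 := h.b_mem
  have h4 := h.d_mem
  have h5 := h.ne_of_mem hs
  have h6 := h.ne_of_mem ht
  simp only [splicedCycle]
  constructor
  · grind
  · intro h7
    have := h7.ne
    grind

theorem cycle_adj_cross (h : Surgery T C v x y w a b c d A B) {s t : V} (hs : s ∈ A)
    (ht : t ∈ B) (hst : (splicedCycle C x a b c d).Adj s t) :
    (s = a ∧ t = d) ∨ (s = c ∧ t = b) := by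
  have h1 := h.disjoint hs
  have h3 := h.b_mem
  have h4 := h.d_mem
  have h5 := h.cross s hs t ht
  simp only [splicedCycle] at hst
  grind

theorem tree_adj_mem (h : Surgery T C v x y w a b c d A B) {s t : V}
    (hst : (splicedTree T v x y w).Adj s t) : (s ∈ A ∨ s ∈ B) ∧ (t ∈ A ∨ t ∈ B) := by
  obtain ⟨-, ⟨h1, h2, h3, h4⟩, -⟩ := hst
  have := h.cover s
  have := h.cover t
  tauto

theorem isLeaf_corners (h : Surgery T C v x y w a b c d A B) :
    IsLeaf T a ∧ IsLeaf T b ∧ IsLeaf T c ∧ IsLeaf T d :=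
  ⟨h.isLeaf_of_adj a x ((h.cycle_adj_x a).2 (Or.inl rfl)).symm,
    h.isLeaf_of_adj b x ((h.cycle_adj_x b).2 (Or.inr rfl)).symm,
    h.isLeaf_of_adj c d h.adj_cd, h.isLeaf_of_adj d c h.adj_cd.symm⟩

theorem cycle_adj_isLeaf (h : Surgery T C v x y w a b c d A B) {s t : V}
    (hst : (splicedCycle C x a b c d).Adj s t) : IsLeaf T s ∧ s ≠ x := by
  obtain ⟨ha, hb, hc, hd⟩ := h.isLeaf_corners
  obtain ⟨-, ⟨h1, -⟩, h2⟩ := hst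
  refine ⟨?_, h1⟩
  rcases h2 with h2 | ⟨rfl, -⟩ | ⟨rfl, -⟩ | ⟨rfl, -⟩ | ⟨rfl, -⟩
  · exact h.isLeaf_of_adj _ _ h2.1
  all_goals assumption

theorem tree_not_adj_of_isLeaf (h : Surgery T C v x y w a b c d A B) {s t : V}
    (hs : IsLeaf T s) (ht : IsLeaf T t) : ¬ (splicedTree T v x y w).Adj s t := by
  rintro ⟨-, -, h1 | ⟨rfl, -⟩ | ⟨rfl, -⟩⟩
  · exact h.leaf_adj _ _ hs ht h1
  · exact h.leaf_y hs
  · exact h.leaf_w hs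

/-! ### The new tree -/

theorem side_splicedTree (h : Surgery T C v x y w a b c d A B) {p q z : V} (hpq : T.Adj p q)
    (hp : p ≠ v ∧ p ≠ x) (hq : q ≠ v ∧ q ≠ x) (hz : z ≠ v ∧ z ≠ x) :
    z ∈ Side (splicedTree T v x y w) p q ↔ z ∈ Side T p q := by
  classical
  have hvne : ∀ t, s(v, t) ≠ s(p, q) := by
    intro t; rw [Ne, Sym2.eq_iff]; grind
  have hyw : s(y, w) ≠ s(p, q) := by
    intro e
    have : T.Adj y w := by rw [← SimpleGraph.mem_edgeSet, e]; exact hpq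
    exact h.not_adj_AB h.y_mem h.w_mem this
  have hvy : (T.deleteEdges {s(p, q)}).Reachable y v := by
    refine (Adj.reachable ?_).symm
    rw [SimpleGraph.deleteEdges_adj]; exact ⟨h.adj_vy, hvne y⟩
  have hvw : (T.deleteEdges {s(p, q)}).Reachable v w := by
    refine Adj.reachable ?_
    rw [SimpleGraph.deleteEdges_adj]; exact ⟨h.adj_vw, hvne w⟩
  have hnew : ((splicedTree T v x y w).deleteEdges {s(p, q)}).Reachable y w := by
    refine Adj.reachable ?_
    rw [SimpleGraph.deleteEdges_adj]
    exact ⟨⟨h.y_ne_w, ⟨(h.ne_of_mem h.y_mem).1, (h.ne_of_mem h.y_mem).2,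
      (h.swap.ne_of_mem h.w_mem).1, (h.swap.ne_of_mem h.w_mem).2⟩, by tauto⟩, hyw⟩
  constructor
  · intro h1
    refine reachable_map_of_adj id ?_ h1
    intro s t hst
    rw [SimpleGraph.deleteEdges_adj] at hst
    obtain ⟨⟨-, -, h2 | ⟨rfl, rfl⟩ | ⟨rfl, rfl⟩⟩, hne⟩ := hst
    · refine Adj.reachable ?_
      rw [SimpleGraph.deleteEdges_adj]; exact ⟨h2, hne⟩
    · exact hvy.trans hvw
    · exact (hvy.trans hvw).symm
  · intro h1
    have := reachable_map_of_adj (G' := (splicedTree T v x y w).deleteEdges {s(p, q)})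
      (fun z => if z = v ∨ z = x then y else z) ?_ h1
    · rw [if_neg (by tauto), if_neg (by tauto)] at this
      exact this
    intro s t hst
    rw [SimpleGraph.deleteEdges_adj] at hst
    have hcase : ∀ t, T.Adj v t →
        ((splicedTree T v x y w).deleteEdges {s(p, q)}).Reachable y
          (if t = v ∨ t = x then y else t) := by
      intro t ht
      split_ifs with h3
      · exact Reachable.refl _
      · rcases (h.adj_v t).1 ht with rfl | rfl | rfl
        · simp at h3
        · exact Reachable.refl _
        · exact hnew
    by_cases hs : s = v
    · subst hs
      simpa using hcase t hst.1
    by_cases ht : t = v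
    · subst ht
      simpa using (hcase s hst.1.symm).symm
    have hsx : s ≠ x := by rintro rfl; exact ht ((h.adj_x t).1 hst.1)
    have htx : t ≠ x := by rintro rfl; exact hs ((h.adj_x s).1 hst.1.symm)
    simp only [hs, ht, hsx, htx, or_self, if_false]
    refine Adj.reachable ?_
    rw [SimpleGraph.deleteEdges_adj]
    exact ⟨⟨hst.1.ne, ⟨hs, hsx, ht, htx⟩, Or.inl hst.1⟩, hst.2⟩

theorem side_splicedTree_new (h : Surgery T C v x y w a b c d A B) (z : V) :
    z ∈ Side (splicedTree T v x y w) y w ↔ z ∈ A := by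
  constructor
  · refine fun hz => side_induction (P := (· ∈ A)) h.y_mem ?_ z hz
    intro s t _ hs hst hne
    obtain ⟨-, ⟨-, -, ht, -⟩, h2 | ⟨rfl, rfl⟩ | ⟨rfl, rfl⟩⟩ := hst
    · exact (h.closed hs h2).resolve_right fun h3 => ht h3.2
    · exact absurd rfl hne
    · exact absurd Sym2.eq_swap hne
  · intro hz
    have hz' := hz
    rw [h.eq_A] at hz
    refine side_induction (P := fun z => z ∈ Side (splicedTree T v x y w) y w)
      (mem_side_self _ _) ?_ z hz
    intro s t hs hP hst hne
    have ht := side_step hs hst hne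
    rw [← h.eq_A] at hs ht
    obtain ⟨h1, h2⟩ := h.ne_of_mem hs
    obtain ⟨h3, h4⟩ := h.ne_of_mem ht
    refine side_step hP ⟨hst.ne, ⟨h1, h2, h3, h4⟩, Or.inl hst⟩ ?_
    intro e
    have : T.Adj y w := by rw [← SimpleGraph.mem_edgeSet, ← e]; exact hst
    exact h.not_adj_AB h.y_mem h.w_mem this

theorem notMem_side_splicedTree (h : Surgery T C v x y w a b c d A B) {p q : V}
    (hpq : (splicedTree T v x y w).Adj p q) : q ∉ Side (splicedTree T v x y w) p q := by
  obtain ⟨-, ⟨h1, h2, h3, h4⟩, h5 | ⟨rfl, rfl⟩ | ⟨rfl, rfl⟩⟩ := hpq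
  · rw [h.side_splicedTree h5 ⟨h1, h2⟩ ⟨h3, h4⟩ ⟨h3, h4⟩]
    exact notMem_side h.isTree h5
  · rw [h.side_splicedTree_new]
    exact fun h6 => h.disjoint h6 h.w_mem
  · rw [← splicedTree_swap, h.swap.side_splicedTree_new]
    exact h.disjoint h.y_mem

theorem reachable_splicedTree (h : Surgery T C v x y w a b c d A B) {z : V}
    (hz : z ≠ v ∧ z ≠ x) : (splicedTree T v x y w).Reachable y z := by
  have hmono := fun p q : V =>
    SimpleGraph.deleteEdges_le (G := splicedTree T v x y w) ({s(p, q)} : Set (Sym2 V))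
  have hA : ∀ z ∈ A, (splicedTree T v x y w).Reachable y z := fun z hz =>
    Reachable.mono (hmono y w) ((h.side_splicedTree_new z).2 hz)
  have hB : ∀ z ∈ B, (splicedTree T v x y w).Reachable w z := fun z hz => by
    have := (h.swap.side_splicedTree_new z).2 hz
    rw [splicedTree_swap] at this
    exact Reachable.mono (hmono w y) this
  have hyw : (splicedTree T v x y w).Adj y w :=
    ⟨h.y_ne_w, ⟨(h.ne_of_mem h.y_mem).1, (h.ne_of_mem h.y_mem).2,
      (h.swap.ne_of_mem h.w_mem).1, (h.swap.ne_of_mem h.w_mem).2⟩, by tauto⟩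
  rcases h.cover z with h1 | h1 | h1 | h1
  · exact absurd h1 hz.1
  · exact absurd h1 hz.2
  · exact hA z h1
  · exact hyw.reachable.trans (hB z h1)

theorem ncDeg_splicedTree [Finite V] (h : Surgery T C v x y w a b c d A B) {z : V}
    (hz : z ≠ v ∧ z ≠ x) : ncDeg (splicedTree T v x y w) z = ncDeg T z := by
  have key : ∀ {y w a b c d A B} (h : Surgery T C v x y w a b c d A B),
      ncDeg (splicedTree T v x y w) y = ncDeg T y := by
    intro y w a b c d A B h
    have hset : (splicedTree T v x y w).neighborSet y = insert w (T.neighborSet y \ {v}) := by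
      ext t
      have h1 := h.ne_of_mem h.y_mem
      have h2 := h.swap.ne_of_mem h.w_mem
      have h3 := h.y_ne_w
      have h4 : T.Adj y x → y = v := fun h5 => (h.adj_x y).1 h5.symm
      have h5 : T.Adj y t → y ≠ t := fun h => h.ne
      simp only [splicedTree, SimpleGraph.mem_neighborSet, Set.mem_insert_iff, Set.mem_sdiff,
        Set.mem_singleton_iff]
      grind
    unfold ncDeg
    rw [hset]
    exact Set.ncard_exchange (h.not_adj_AB h.y_mem h.w_mem) h.adj_vy.symm
  by_cases hy : z = y
  · subst hy; exact key h
  by_cases hw : z = w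
  · rw [hw, ← splicedTree_swap]
    exact key h.swap
  unfold ncDeg
  congr 1
  ext t
  have h1 : T.Adj z v → z = x ∨ z = y ∨ z = w := fun h5 => (h.adj_v z).1 h5.symm
  have h2 : T.Adj z x → z = v := fun h5 => (h.adj_x z).1 h5.symm
  have h5 : T.Adj z t → z ≠ t := fun h => h.ne
  simp only [splicedTree, SimpleGraph.mem_neighborSet]
  grind

/-! ### The new cycle -/

theorem ncDeg_splicedCycle [Finite V] (h : Surgery T C v x y w a b c d A B) {z : V}
    (hz : z ≠ x) : ncDeg (splicedCycle C x a b c d) z = ncDeg C z := by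
  have key : ∀ {y w a b c d A B} (h : Surgery T C v x y w a b c d A B),
      ncDeg (splicedCycle C x a b c d) a = ncDeg C a ∧
      ncDeg (splicedCycle C x a b c d) c = ncDeg C c := by
    intro y w a b c d A B h
    have h1 := h.a_ne_c
    have h2 := h.b_ne_d
    have ha := h.disjoint h.a_mem
    have hc := h.disjoint h.c_mem
    have hb := h.b_mem
    have hd := h.d_mem
    have h3 := (h.ne_of_mem h.a_mem).2
    have h4 := (h.ne_of_mem h.c_mem).2
    have h5 := (h.swap.ne_of_mem h.b_mem).2
    have h6 := (h.swap.ne_of_mem h.d_mem).2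
    have hax : C.Adj a x := ((h.cycle_adj_x a).2 (Or.inl rfl)).symm
    have hcx : ¬ C.Adj c x := fun hcx => by
      rcases (h.cycle_adj_x c).1 hcx.symm with e | e
      · exact h1 e.symm
      · exact hc (e ▸ hb)
    constructor
    · have hset : (splicedCycle C x a b c d).neighborSet a =
          insert d (C.neighborSet a \ {x}) := by
        ext t
        have h7 : C.Adj a t → a ≠ t := fun h => h.ne
        simp only [splicedCycle, SimpleGraph.mem_neighborSet, Set.mem_insert_iff, Set.mem_sdiff,
          Set.mem_singleton_iff]
        grind
      unfold ncDeg
      rw [hset]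
      refine Set.ncard_exchange (fun h8 => h1 ?_) hax
      exact ((h.cross a h.a_mem d hd).1 h8).1
    · have hset : (splicedCycle C x a b c d).neighborSet c =
          insert b (C.neighborSet c \ {d}) := by
        ext t
        have h7 : C.Adj c t → c ≠ t := fun h => h.ne
        simp only [splicedCycle, SimpleGraph.mem_neighborSet, Set.mem_insert_iff, Set.mem_sdiff,
          Set.mem_singleton_iff]
        grind
      unfold ncDeg
      rw [hset]
      refine Set.ncard_exchange (fun h8 => h2 ?_) h.adj_cd
      exact ((h.cross c h.c_mem b hb).1 h8).2
  by_cases ha : z = a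
  · exact ha ▸ (key h).1
  by_cases hc : z = c
  · exact hc ▸ (key h).2
  by_cases hb : z = b
  · rw [hb, ← splicedCycle_swap]; exact (key h.swap).1
  by_cases hd : z = d
  · rw [hd, ← splicedCycle_swap]; exact (key h.swap).2
  unfold ncDeg
  congr 1
  ext t
  have h1 : C.Adj z x → z = a ∨ z = b := fun h5 => (h.cycle_adj_x z).1 h5.symm
  have h5 : C.Adj z t → z ≠ t := fun h => h.ne
  simp only [splicedCycle, SimpleGraph.mem_neighborSet]
  grind

theorem connOn_of_subset (h : Surgery T C v x y w a b c d A B) {S : Set V} (hS : ConnOn C S)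
    (hsub : S ⊆ A) : ConnOn (splicedCycle C x a b c d) S :=
  hS.map id hS.1 (fun z hz => ⟨z, hz, rfl⟩) fun _ hs _ ht hst =>
    Relation.ReflTransGen.single ⟨(h.cycle_adj_same (hsub hs) (hsub ht)).2 hst, hs, ht⟩

theorem connOn_of_superset (h : Surgery T C v x y w a b c d A B) {S : Set V} (hS : ConnOn C S)
    (hx : x ∈ S) (hsup : ∀ z, IsLeaf T z → z ∈ B → z ∈ S) :
    ConnOn (splicedCycle C x a b c d) (S \ {x}) := by
  classical
  obtain ⟨hla, hlb, hlc, hld⟩ := h.isLeaf_corners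
  have hax := (h.ne_of_mem h.a_mem).2
  have hcx := (h.ne_of_mem h.c_mem).2
  have hbx := (h.swap.ne_of_mem h.b_mem).2
  have hdx := (h.swap.ne_of_mem h.d_mem).2
  have hbS : b ∈ S \ {x} := ⟨hsup b hlb h.b_mem, hbx⟩
  have hdS : d ∈ S \ {x} := ⟨hsup d hld h.d_mem, hdx⟩
  set R := fun s t => (splicedCycle C x a b c d).Adj s t ∧ s ∈ S \ {x} ∧ t ∈ S \ {x}
  have : Std.Symm R := ⟨fun s t ⟨h1, h2, h3⟩ => ⟨h1.symm, h3, h2⟩⟩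
  have hsymm : ∀ {s t}, Relation.ReflTransGen R s t → Relation.ReflTransGen R t s :=
    fun h1 => Std.Symm.symm _ _ h1
  have hbd : Relation.ReflTransGen R b d := by
    have h1 := h.connB.2 b ⟨hlb, h.b_mem⟩ d ⟨hld, h.d_mem⟩
    refine Relation.ReflTransGen.mono ?_ _ _ h1
    rintro s t ⟨hst, hs, ht⟩
    refine ⟨?_, ⟨hsup s hs.1 hs.2, (h.swap.ne_of_mem hs.2).2⟩,
      ⟨hsup t ht.1 ht.2, (h.swap.ne_of_mem ht.2).2⟩⟩
    rw [← splicedCycle_swap, h.swap.cycle_adj_same hs.2 ht.2]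
    exact hst
  have hba : a ∈ S → Relation.ReflTransGen R b a := fun ha =>
    hbd.tail ⟨⟨fun e => h.disjoint h.a_mem (e ▸ h.d_mem), ⟨hdx, hax⟩, by tauto⟩, hdS, ha, hax⟩
  have hcd : c ∈ S → Relation.ReflTransGen R c d := fun hc =>
    Relation.ReflTransGen.head
      ⟨⟨fun e => h.disjoint h.c_mem (e ▸ h.b_mem), ⟨hcx, hbx⟩, by tauto⟩, ⟨hc, hcx⟩, hbS⟩ hbd
  have hxt : ∀ t ∈ S, C.Adj x t → Relation.ReflTransGen R b (if t = x then b else t) := by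
    intro t ht hxt
    rw [if_neg hxt.ne']
    rcases (h.cycle_adj_x t).1 hxt with rfl | rfl
    · exact hba ht
    · exact Relation.ReflTransGen.refl
  refine hS.map (fun z => if z = x then b else z) ⟨b, hbS⟩ ?_ ?_
  · rintro z ⟨hz, hzx⟩
    exact ⟨z, hz, if_neg hzx⟩
  intro s hs t ht hst
  change Relation.ReflTransGen R _ _
  by_cases hsx : s = x
  · subst hsx
    simpa using hxt t ht hst
  by_cases htx : t = x
  · subst htx
    simpa using hsymm (hxt s hs hst.symm)
  simp only [hsx, htx, if_false]
  by_cases h1 : s = c ∧ t = d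
  · obtain ⟨rfl, rfl⟩ := h1
    exact hcd hs
  by_cases h2 : s = d ∧ t = c
  · obtain ⟨rfl, rfl⟩ := h2
    exact hsymm (hcd ht)
  exact Relation.ReflTransGen.single
    ⟨⟨hst.ne, ⟨hsx, htx⟩, Or.inl ⟨hst, h1, h2⟩⟩, ⟨hs, hsx⟩, ht, htx⟩

theorem planar_splice (h : Surgery T C v x y w a b c d A B)
    (hplanar : ∀ p q, T.Adj p q → ConnOn C {z | IsLeaf T z ∧ z ∈ Side T p q}) {p q : V}
    (hpq : (splicedTree T v x y w).Adj p q) :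
    ConnOn (splicedCycle C x a b c d)
      ({z | IsLeaf T z ∧ z ∈ Side (splicedTree T v x y w) p q} \ {x}) := by
  have key : ∀ {y w a b c d A B} (h : Surgery T C v x y w a b c d A B) {p q : V},
      T.Adj p q → p ∈ A → q ∈ A → ConnOn (splicedCycle C x a b c d)
      ({z | IsLeaf T z ∧ z ∈ Side (splicedTree T v x y w) p q} \ {x}) := by
    intro y w a b c d A B h p q hpq hp hq
    have hset : {z | IsLeaf T z ∧ z ∈ Side (splicedTree T v x y w) p q} \ {x} =
        {z | IsLeaf T z ∧ z ∈ Side T p q} \ {x} := by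
      ext z
      have h1 := h.side_splicedTree (z := z) hpq (h.ne_of_mem hp) (h.ne_of_mem hq)
      have h2 : IsLeaf T z → z ≠ v := fun h2 e => h.leaf_v (e ▸ h2)
      simp only [Set.mem_sdiff, Set.mem_ofPred_eq, Set.mem_singleton_iff]
      tauto
    rw [hset]
    by_cases hv : v ∈ Side T p q
    · refine h.connOn_of_superset (hplanar p q hpq)
        ⟨h.leaf_x, h.compl_subset_side hp hq hv h.x_notMem⟩ fun z hz hzB =>
          ⟨hz, h.compl_subset_side hp hq hv (h.swap.disjoint hzB)⟩
    · have hv' := (side_cover h.isTree hpq v).resolve_left hv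
      have hsub : {z | IsLeaf T z ∧ z ∈ Side T p q} ⊆ A := by
        rintro z ⟨-, hz⟩
        by_contra hzA
        exact side_disjoint h.isTree hpq hz (h.compl_subset_side hq hp hv' hzA)
      rw [Set.sdiff_singleton_eq_self fun hx => h.x_notMem (hsub hx)]
      exact h.connOn_of_subset (hplanar p q hpq) hsub
  have key' : ∀ {y w a b c d A B} (h : Surgery T C v x y w a b c d A B),
      ConnOn (splicedCycle C x a b c d)
      ({z | IsLeaf T z ∧ z ∈ Side (splicedTree T v x y w) y w} \ {x}) := by
    intro y w a b c d A B h
    simp only [h.side_splicedTree_new]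
    rw [Set.sdiff_singleton_eq_self fun hx => h.x_notMem hx.2]
    exact h.connOn_of_subset h.connA fun z hz => hz.2
  obtain ⟨hpm, hqm⟩ := h.tree_adj_mem hpq
  obtain ⟨-, -, h5 | ⟨rfl, rfl⟩ | ⟨rfl, rfl⟩⟩ := hpq
  · rcases hpm with hp | hp <;> rcases hqm with hq | hq
    · exact key h h5 hp hq
    · exact absurd h5 (h.not_adj_AB hp hq)
    · exact absurd h5.symm (h.not_adj_AB hq hp)
    · rw [← splicedTree_swap, ← splicedCycle_swap]
      exact key h.swap h5 hp hq
  · exact key' h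
  · rw [← splicedTree_swap, ← splicedCycle_swap]
    exact key' h.swap

/-! ### No four-cycles -/

theorem isAcyclic_splicedTree (h : Surgery T C v x y w a b c d A B) :
    (splicedTree T v x y w).IsAcyclic := by
  rw [SimpleGraph.isAcyclic_iff_forall_adj_isBridge]
  intro p q hpq
  rw [SimpleGraph.isBridge_iff]
  exact h.notMem_side_splicedTree hpq

/-- The cycle contains no four-cycle. -/
theorem splicedCycle_no_square (h : Surgery T C v x y w a b c d A B) (hfree : C4Free (T ⊔ C))
    {p q r s : V} (hp : p ∈ A) (hpq : (splicedCycle C x a b c d).Adj p q)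
    (hqr : (splicedCycle C x a b c d).Adj q r) (hrs : (splicedCycle C x a b c d).Adj r s)
    (hsp : (splicedCycle C x a b c d).Adj s p) (hpr : p ≠ r) (hqs : q ≠ s) : False := by
  have hmem : ∀ {s t}, (splicedCycle C x a b c d).Adj s t → s ∈ A ∨ s ∈ B := fun hst =>
    h.mem_of_isLeaf (h.cycle_adj_isLeaf hst).1 (h.cycle_adj_isLeaf hst).2
  have hA : ∀ {s t}, s ∈ A → t ∈ A → (splicedCycle C x a b c d).Adj s t → C.Adj s t :=
    fun hs ht => (h.cycle_adj_same hs ht).1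
  have hB : ∀ {s t}, s ∈ B → t ∈ B → (splicedCycle C x a b c d).Adj s t → C.Adj s t :=
    fun hs ht h1 => by
      rw [← splicedCycle_swap, h.swap.cycle_adj_same hs ht] at h1; exact h1
  have hX : ∀ {s t}, s ∈ A → t ∈ B → (splicedCycle C x a b c d).Adj s t →
      (s = a ∧ t = d) ∨ (s = c ∧ t = b) := fun hs ht h1 => h.cycle_adj_cross hs ht h1
  have hac := h.not_adj_ac
  have hac' : ¬ C.Adj c a := fun h1 => hac h1.symm
  have hne1 := h.a_ne_c
  have hne2 := h.b_ne_d
  have hne3 := hpq.ne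
  have hne4 := hsp.ne
  rcases hmem hqr with hq | hq <;> rcases hmem hrs with hr | hr <;>
    rcases hmem hsp with hs | hs
  · refine hqs ((c4Free_iff _).1 hfree p q r s ?_ ?_ ?_ ?_ hpr)
    · exact Or.inr (hA hp hq hpq)
    · exact Or.inr (hA hq hr hqr)
    · exact Or.inr (hA hr hs hrs)
    · exact Or.inr (hA hs hp hsp)
  · have := hX hr hs hrs; have := hX hp hs hsp.symm; grind
  · have := hX hq hr hqr; have := hX hs hr hrs.symm; grind
  · have := hX hq hr hqr; have := hX hp hs hsp.symm; have := hA hp hq hpq; grind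
  · have := hX hp hq hpq; have := hX hr hq hqr.symm; grind
  · have := hX hp hq hpq; have := hX hr hq hqr.symm; grind
  · have := hX hp hq hpq; have := hX hs hr hrs.symm; have := hA hs hp hsp; grind
  · have := hX hp hq hpq; have := hX hp hs hsp.symm; grind

/-- No four-cycle consists of two cycle edges followed by two tree edges. -/
theorem splice_no_square_two (h : Surgery T C v x y w a b c d A B) (hfree : C4Free (T ⊔ C))
    {p q r s : V} (hp : p ∈ A) (hpq : (splicedCycle C x a b c d).Adj p q)
    (hqr : (splicedCycle C x a b c d).Adj q r) (hrs : (splicedTree T v x y w).Adj r s)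
    (hsp : (splicedTree T v x y w).Adj s p) (hpr : p ≠ r) (hqs : q ≠ s) : False := by
  have hlp := (h.cycle_adj_isLeaf hpq).1
  have hlr := (h.cycle_adj_isLeaf hqr.symm).1
  have hpy : p ≠ y := fun e => h.leaf_y (e ▸ hlp)
  have hrw : r ≠ w := fun e => h.leaf_w (e ▸ hlr)
  have hry : r ≠ y := fun e => h.leaf_y (e ▸ hlr)
  have hs : s ∈ A := (h.tree_adj_mem hsp).1.resolve_right fun hs =>
    hpy (h.tree_adj_cross hp hs hsp.symm).1
  have hr : r ∈ A := (h.tree_adj_mem hrs).1.resolve_right fun hr =>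
    hrw (h.tree_adj_cross hs hr hrs.symm).2
  rcases h.mem_of_isLeaf (h.cycle_adj_isLeaf hqr).1 (h.cycle_adj_isLeaf hqr).2 with hq | hq
  · refine hqs ((c4Free_iff _).1 hfree p q r s ?_ ?_ ?_ ?_ hpr)
    · exact Or.inr ((h.cycle_adj_same hp hq).1 hpq)
    · exact Or.inr ((h.cycle_adj_same hq hr).1 hqr)
    · exact Or.inl (h.tree_adj_same hr hs hrs)
    · exact Or.inl (h.tree_adj_same hs hp hsp)
  · have := h.cycle_adj_cross hp hq hpq
    have := h.cycle_adj_cross hr hq hqr.symm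
    have := h.b_ne_d
    grind

/-- No four-cycle consists of one cycle edge followed by three tree edges. -/
theorem splice_no_square_three (h : Surgery T C v x y w a b c d A B) (hfree : C4Free (T ⊔ C))
    {p q r s : V} (hp : p ∈ A) (hpq : (splicedCycle C x a b c d).Adj p q)
    (hqr : (splicedTree T v x y w).Adj q r) (hrs : (splicedTree T v x y w).Adj r s)
    (hsp : (splicedTree T v x y w).Adj s p) (hpr : p ≠ r) (hqs : q ≠ s) : False := by
  have hlp := (h.cycle_adj_isLeaf hpq).1
  have hlq := (h.cycle_adj_isLeaf hpq.symm).1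
  have hpy : p ≠ y := fun e => h.leaf_y (e ▸ hlp)
  have hqw : q ≠ w := fun e => h.leaf_w (e ▸ hlq)
  have hqy : q ≠ y := fun e => h.leaf_y (e ▸ hlq)
  have hs : s ∈ A := (h.tree_adj_mem hsp).1.resolve_right fun hs =>
    hpy (h.tree_adj_cross hp hs hsp.symm).1
  rcases (h.tree_adj_mem hqr).1 with hq | hq
  · have hr : r ∈ A := (h.tree_adj_mem hqr).2.resolve_right fun hr =>
      hqy (h.tree_adj_cross hq hr hqr).1
    refine hqs ((c4Free_iff _).1 hfree p q r s ?_ ?_ ?_ ?_ hpr)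
    · exact Or.inr ((h.cycle_adj_same hp hq).1 hpq)
    · exact Or.inl (h.tree_adj_same hq hr hqr)
    · exact Or.inl (h.tree_adj_same hr hs hrs)
    · exact Or.inl (h.tree_adj_same hs hp hsp)
  · have hr : r ∈ B := (h.tree_adj_mem hqr).2.resolve_left fun hr =>
      hqw (h.tree_adj_cross hr hq hqr.symm).2
    obtain ⟨rfl, rfl⟩ := h.tree_adj_cross hs hr hrs.symm
    rcases h.cycle_adj_cross hp hq hpq with ⟨rfl, rfl⟩ | ⟨rfl, rfl⟩
    · exact h.not_adj_ay (h.tree_adj_same hs hp hsp).symm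
    · rw [← splicedTree_swap] at hqr
      exact h.not_adj_bw (h.swap.tree_adj_same hq hr hqr)

theorem c4Free_splice (h : Surgery T C v x y w a b c d A B) (hfree : C4Free (T ⊔ C)) :
    C4Free (splicedTree T v x y w ⊔ splicedCycle C x a b c d) := by
  have hTT : ∀ {p q r s}, (splicedTree T v x y w).Adj p q → (splicedTree T v x y w).Adj q r →
      (splicedTree T v x y w).Adj r s → (splicedTree T v x y w).Adj s p → p ≠ r → q ≠ s →
      False := fun h1 h2 h3 h4 hpr hqs =>
    hqs ((c4Free_iff _).1 (fun _ c hc => absurd hc (h.isAcyclic_splicedTree c))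
      _ _ _ _ h1 h2 h3 h4 hpr)
  have hmem : ∀ {s t}, (splicedCycle C x a b c d).Adj s t → s ∈ A ∨ s ∈ B := fun hst =>
    h.mem_of_isLeaf (h.cycle_adj_isLeaf hst).1 (h.cycle_adj_isLeaf hst).2
  have hCC : ∀ {p q r s}, (splicedCycle C x a b c d).Adj p q →
      (splicedCycle C x a b c d).Adj q r → (splicedCycle C x a b c d).Adj r s →
      (splicedCycle C x a b c d).Adj s p → p ≠ r → q ≠ s → False :=
    fun h1 h2 h3 h4 hpr hqs => by
      rcases hmem h1 with hp | hp
      · exact h.splicedCycle_no_square hfree hp h1 h2 h3 h4 hpr hqs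
      · rw [← splicedCycle_swap] at h1 h2 h3 h4
        exact h.swap.splicedCycle_no_square hfree hp h1 h2 h3 h4 hpr hqs
  have hCT : ∀ {p q r s}, (splicedCycle C x a b c d).Adj p q →
      (splicedCycle C x a b c d).Adj q r → (splicedTree T v x y w).Adj r s →
      (splicedTree T v x y w).Adj s p → p ≠ r → q ≠ s → False :=
    fun h1 h2 h3 h4 hpr hqs => by
      rcases hmem h1 with hp | hp
      · exact h.splice_no_square_two hfree hp h1 h2 h3 h4 hpr hqs
      · rw [← splicedCycle_swap] at h1 h2
        rw [← splicedTree_swap] at h3 h4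
        exact h.swap.splice_no_square_two hfree hp h1 h2 h3 h4 hpr hqs
  have hCTT : ∀ {p q r s}, (splicedCycle C x a b c d).Adj p q →
      (splicedTree T v x y w).Adj q r → (splicedTree T v x y w).Adj r s →
      (splicedTree T v x y w).Adj s p → p ≠ r → q ≠ s → False :=
    fun h1 h2 h3 h4 hpr hqs => by
      rcases hmem h1 with hp | hp
      · exact h.splice_no_square_three hfree hp h1 h2 h3 h4 hpr hqs
      · rw [← splicedCycle_swap] at h1
        rw [← splicedTree_swap] at h2 h3 h4
        exact h.swap.splice_no_square_three hfree hp h1 h2 h3 h4 hpr hqs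
  have hCTC : ∀ {p q r s}, (splicedCycle C x a b c d).Adj p q →
      (splicedTree T v x y w).Adj q r → (splicedCycle C x a b c d).Adj r s → False :=
    fun h1 h2 h3 => h.tree_not_adj_of_isLeaf (h.cycle_adj_isLeaf h1.symm).1
      (h.cycle_adj_isLeaf h3).1 h2
  rw [c4Free_iff]
  intro p q r s h1 h2 h3 h4 hpr
  by_contra hqs
  rcases h1 with h1 | h1 <;> rcases h2 with h2 | h2 <;> rcases h3 with h3 | h3 <;>
    rcases h4 with h4 | h4
  · exact hTT h1 h2 h3 h4 hpr hqs
  · exact hCTT h4 h1 h2 h3 (Ne.symm hqs) hpr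
  · exact hCTT h3 h4 h1 h2 hpr.symm (Ne.symm hqs)
  · exact hCT h3 h4 h1 h2 hpr.symm (Ne.symm hqs)
  · exact hCTT h2 h3 h4 h1 hqs hpr.symm
  · exact hCTC h4 h1 h2
  · exact hCT h2 h3 h4 h1 hqs hpr.symm
  · exact hCTC h4 h1 h2
  · exact hCTT h1 h2 h3 h4 hpr hqs
  · exact hCT h4 h1 h2 h3 (Ne.symm hqs) hpr
  · exact hCTC h1 h2 h3
  · exact hCTC h1 h2 h3
  · exact hCT h1 h2 h3 h4 hpr hqs
  · exact hCTC h2 h3 h4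
  · exact hCTC h3 h4 h1
  · exact hCC h1 h2 h3 h4 hpr hqs

end Surgery

/-! ### Locating the corners -/

section Corners

variable {V : Type*}

theorem ConnOn.exists_crossing {C : SimpleGraph V} {S : Set V} (h : ConnOn C S) {P : V → Prop}
    {s t : V} (hs : s ∈ S) (hPs : P s) (ht : t ∈ S) (hPt : ¬ P t) :
    ∃ p ∈ S, ∃ q ∈ S, P p ∧ ¬ P q ∧ C.Adj p q := by
  by_contra! hno
  exact hPt (h.invariant hs hPs (fun p hp q hq hPp hpq => by
    by_contra hPq
    exact hno p hp q hq hPp hPq hpq) t ht)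

theorem eq_or_eq_of_ncDeg_eq_two {C : SimpleGraph V} {z p q r : V} (h : ncDeg C z = 2)
    (hp : C.Adj z p) (hq : C.Adj z q) (hpq : p ≠ q) (hr : C.Adj z r) : r = p ∨ r = q := by
  have hfin : (C.neighborSet z).Finite := Set.finite_of_ncard_ne_zero (by
    unfold ncDeg at h; omega)
  have hsub : ({p, q} : Set V) ⊆ C.neighborSet z := by
    rintro t (rfl | rfl)
    · exact hp
    · exact hq
  have := Set.eq_of_subset_of_ncard_le hsub
    (by rw [Set.ncard_pair hpq]; exact h.le) hfin
  have h1 : r ∈ C.neighborSet z := hr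
  rwa [← this] at h1

variable [Fintype V] (H : HalinGraph V)

theorem HalinGraph.ncDeg_cycle {p q : V} (h : H.C.Adj p q) : ncDeg H.C p = 2 :=
  H.two_regular p ⟨q, h⟩

theorem HalinGraph.connOn_side {p q : V} (h : H.T.Adj p q) :
    ConnOn H.C {z | IsLeaf H.T z ∧ z ∈ Side H.T p q} :=
  (connected_induce_iff_connOn _ _).1 (H.planar p q h)

/-- The two cycle edges leaving a branch end at distinct leaves that are not adjacent, and these
edges are the only ones leaving it. -/
theorem HalinGraph.branch_corners (hfree : C4Free H.graph) {v x y w a c d : V} {A B : Set V}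
    (h : Branches H.T v x y w A B) (ha : a ∈ A) (hc : c ∈ A) (hd : d ∈ B)
    (hax : H.C.Adj a x) (hcd : H.C.Adj c d) :
    a ≠ c ∧ ¬ H.T.Adj a y ∧ ¬ H.C.Adj a c ∧ ∀ s ∈ A, ∀ t ∈ B, H.C.Adj s t → s = c ∧ t = d := by
  have hfree' := (c4Free_iff _).1 hfree
  have hA := h.eq_A
  have hconn : ConnOn H.C {z | IsLeaf H.T z ∧ z ∈ A} := by
    rw [hA]; exact H.connOn_side h.adj_vy.symm
  have hla := H.isLeaf_of_adj hax
  have hlc := H.isLeaf_of_adj hcd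
  have hxd : x ≠ d := fun e => h.swap.x_notMem (e ▸ hd)
  have hac : a ≠ c := by
    rintro rfl
    obtain ⟨z, z', hne, hz, hz', hl, hl'⟩ :=
      exists_two_leaves_mem_side H.tree_isTree H.nonleaf_degree (p := v) h.leaf_y
    rw [← hA] at hz hz'
    obtain ⟨t, ht, hta⟩ : ∃ t, (IsLeaf H.T t ∧ t ∈ A) ∧ t ≠ a := by
      by_cases e : z = a
      · exact ⟨z', ⟨hl', hz'⟩, fun e' => hne (e.trans e'.symm)⟩
      · exact ⟨z, ⟨hl, hz⟩, e⟩
    obtain ⟨p, -, q, hq, rfl, -, hpq⟩ :=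
      hconn.exists_crossing (P := (· = a)) (s := a) ⟨hla, ha⟩ rfl ht hta
    rcases eq_or_eq_of_ncDeg_eq_two (H.ncDeg_cycle hax) hax hcd hxd hpq with e | e
    · exact h.x_notMem (e ▸ hq.2)
    · exact h.disjoint hq.2 (e ▸ hd)
  have hay : ¬ H.T.Adj a y := fun hay => by
    refine h.x_ne_y (hfree' a x v y (Or.inr hax) (Or.inl h.adj_vx.symm) (Or.inl h.adj_vy)
      (Or.inl hay.symm) ?_)
    exact fun e => h.v_notMem (e ▸ ha)
  refine ⟨hac, hay, fun hadj => ?_, fun s hs t ht hst => ?_⟩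
  · have hleaf : ∀ z ∈ {z | IsLeaf H.T z ∧ z ∈ A}, z = a ∨ z = c := by
      refine hconn.invariant (P := fun z => z = a ∨ z = c) (s := a) ⟨hla, ha⟩ (Or.inl rfl) ?_
      rintro p - q hq (rfl | rfl) hpq
      · rcases eq_or_eq_of_ncDeg_eq_two (H.ncDeg_cycle hax) hax hadj
          (fun e => h.x_notMem (e ▸ hc)) hpq with e | e
        · exact absurd (e ▸ hq.2) h.x_notMem
        · exact Or.inr e
      · rcases eq_or_eq_of_ncDeg_eq_two (H.ncDeg_cycle hcd) hcd hadj.symm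
          (fun e => h.disjoint ha (e ▸ hd)) hpq with e | e
        · exact absurd (e ▸ hd) (h.disjoint hq.2)
        · exact Or.inl e
    obtain ⟨r, r', hne, hrv, hrv', hyr, hyr'⟩ :=
      exists_two_other_neighbors (p := v) (H.nonleaf_degree y h.leaf_y)
    have key : ∀ r r', r ≠ r' → r ≠ v → r' ≠ v → H.T.Adj y r → H.T.Adj y r' →
        r = c := by
      intro r r' hne hrv hrv' hyr hyr'
      have hsub := side_subset H.tree_isTree hyr hrv
      have hsub' := side_subset H.tree_isTree hyr' hrv'
      rw [← hA] at hsub hsub'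
      by_cases hl : IsLeaf H.T r
      · refine (hleaf r ⟨hl, hsub (mem_side_self _ _)⟩).resolve_left ?_
        rintro rfl
        exact hay hyr.symm
      · obtain ⟨z, z', hzz, hz, hz', hlz, hlz'⟩ :=
          exists_two_leaves_mem_side H.tree_isTree H.nonleaf_degree (p := y) hl
        obtain ⟨z'', hz'', hlz''⟩ := exists_leaf_mem_side H.tree_isTree H.nonleaf_degree hyr'
        have h1 := hleaf z ⟨hlz, hsub hz⟩
        have h2 := hleaf z' ⟨hlz', hsub hz'⟩
        have h3 := hleaf z'' ⟨hlz'', hsub' hz''⟩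
        have h4 := branches_disjoint H.tree_isTree hyr hyr' hne hz
        have h5 := branches_disjoint H.tree_isTree hyr hyr' hne hz'
        exfalso
        rcases h1 with rfl | rfl <;> rcases h2 with rfl | rfl <;> rcases h3 with rfl | rfl <;>
          contradiction
    exact hne ((key r r' hne hrv hrv' hyr hyr').trans
      (key r' r hne.symm hrv' hrv hyr' hyr).symm)
  · by_contra hne
    have hle := hconn.card_boundary_le fun z hz =>
      H.two_regular z (by rw [H.support_C]; exact hz.1)
    have hsub : ({(a, x), (c, d), (s, t)} : Set (V × V)) ⊆
        {e | e.1 ∈ {z | IsLeaf H.T z ∧ z ∈ A} ∧ e.2 ∉ {z | IsLeaf H.T z ∧ z ∈ A} ∧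
          H.C.Adj e.1 e.2} := by
      rintro e (rfl | rfl | rfl)
      · exact ⟨⟨hla, ha⟩, fun h1 => h.x_notMem h1.2, hax⟩
      · exact ⟨⟨hlc, hc⟩, fun h1 => h.disjoint h1.2 hd, hcd⟩
      · exact ⟨⟨H.isLeaf_of_adj hst, hs⟩, fun h1 => h.disjoint h1.2 ht, hst⟩
    have h3 : ({(a, x), (c, d), (s, t)} : Set (V × V)).ncard = 3 := by
      rw [Set.ncard_eq_three]
      refine ⟨_, _, _, ?_, ?_, ?_, rfl⟩
      · simp [hac]
      · rintro e
        exact h.swap.x_notMem ((Prod.mk.inj e).2 ▸ ht)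
      · rintro e
        exact hne ⟨(Prod.mk.inj e).1.symm, (Prod.mk.inj e).2.symm⟩
    have := Set.ncard_le_ncard hsub (Set.toFinite _)
    omega

/-- The configuration around a semi-branching vertex of degree three. -/
theorem HalinGraph.exists_surgery (hfree : C4Free H.graph) {v : V}
    (hsb : SemiBranching H.T v) (hdeg : ncDeg H.T v = 3) :
    ∃ x y w a b c d A B, Surgery H.T H.C v x y w a b c d A B := by
  obtain ⟨hlv, ⟨x, hvx, hlx⟩, y, w, hyw, hvy, hvw, hly, hlw⟩ := hsb
  have hxy : x ≠ y := fun e => hly (e ▸ hlx)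
  have hxw : x ≠ w := fun e => hlw (e ▸ hlx)
  have hnbr : H.T.neighborSet v = {x, y, w} := by
    symm
    refine Set.eq_of_subset_of_ncard_le ?_ ?_ (Set.toFinite _)
    · rintro t (rfl | rfl | rfl) <;> assumption
    · rw [Set.ncard_eq_three.2 ⟨x, y, w, hxy, hxw, hyw, rfl⟩]
      exact hdeg.le
  have hB : Branches H.T v x y w (Side H.T y v) (Side H.T w v) :=
    { isTree := H.tree_isTree
      eq_A := rfl
      eq_B := rfl
      adj_v := fun t => by
        rw [← SimpleGraph.mem_neighborSet, hnbr]; simp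
      adj_x := fun t => ⟨fun ht => hlx.eq_of_adj ht hvx.symm, fun e => e ▸ hvx.symm⟩
      x_ne_y := hxy
      x_ne_w := hxw
      y_ne_w := hyw
      leaf_x := hlx
      leaf_v := hlv
      leaf_y := hly
      leaf_w := hlw
      leaf_adj := fun s t hs ht => H.not_adj_of_isLeaf hs ht }
  have hcorner : ∀ {y w A B}, Branches H.T v x y w A B → ∃ a ∈ A, H.C.Adj x a := by
    intro y w A B h
    obtain ⟨z, hz, hlz⟩ := exists_leaf_mem_side H.tree_isTree H.nonleaf_degree h.adj_vy
    rw [← h.eq_A] at hz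
    have hmem : ∀ z, z ∈ Side H.T v w ↔ z ∉ B := fun z => by
      rw [h.eq_B]; exact mem_side_iff_notMem H.tree_isTree h.adj_vw
    obtain ⟨p, -, q, hq, rfl, hqx, hpq⟩ := (H.connOn_side h.adj_vw).exists_crossing
      (P := (· = x)) (s := x) ⟨hlx, (hmem x).2 h.swap.x_notMem⟩ rfl
      ⟨hlz, (hmem z).2 (h.disjoint hz)⟩ fun e => h.x_notMem (e ▸ hz)
    exact ⟨q, (h.mem_of_isLeaf hq.1 hqx).resolve_right ((hmem q).1 hq.2), hpq⟩
  obtain ⟨a, ha, hxa⟩ := hcorner hB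
  obtain ⟨b, hb, hxb⟩ := hcorner hB.swap
  have hmem : ∀ z ≠ x, z ∈ Side H.T v x := by
    intro z hz
    refine (side_cover H.tree_isTree hvx z).resolve_right fun h1 => hz ?_
    refine side_induction (P := (· = x)) rfl ?_ z h1
    rintro s t - rfl hst hne
    exact absurd (by rw [(hB.adj_x t).1 hst]) hne
  obtain ⟨c, -, d, hd, hc, hdA, hcd⟩ := (H.connOn_side hvx).exists_crossing
    (P := (· ∈ Side H.T y v)) (s := a) ⟨H.isLeaf_of_adj hxa.symm, hmem a hxa.ne'⟩ ha
    ⟨H.isLeaf_of_adj hxb.symm, hmem b hxb.ne'⟩ (hB.swap.disjoint hb)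
  have hdB := (hB.mem_of_isLeaf hd.1 fun e => by
    rw [e] at hd
    exact notMem_side H.tree_isTree hvx hd.2).resolve_left hdA
  obtain ⟨h1, h2, h3, h4⟩ := H.branch_corners hfree hB ha hc hdB hxa.symm hcd
  obtain ⟨h5, h6, h7, -⟩ := H.branch_corners hfree hB.swap hb hdB hc hxb.symm hcd.symm
  have hab : a ≠ b := fun e => hB.disjoint ha (e ▸ hb)
  exact ⟨x, y, w, a, b, c, d, _, _,
    { toBranches := hB
      a_mem := ha
      b_mem := hb
      c_mem := hc
      d_mem := hdB
      isLeaf_of_adj := fun s t hst => H.isLeaf_of_adj hst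
      cycle_adj_x := fun t =>
        ⟨eq_or_eq_of_ncDeg_eq_two (H.ncDeg_cycle hxa) hxa hxb hab, by
          rintro (rfl | rfl) <;> assumption⟩
      cross := fun s hs t ht => ⟨h4 s hs t ht, by rintro ⟨rfl, rfl⟩; exact hcd⟩
      a_ne_c := h1
      b_ne_d := h5
      not_adj_ay := h2
      not_adj_bw := h6
      not_adj_ac := h3
      not_adj_bd := h7
      connA := H.connOn_side hvy.symm
      connB := H.connOn_side hvw.symm }⟩

end Corners

/-! ### Relabelling the vertices -/

section Comap

variable {V W : Type*} {G : SimpleGraph V} {f : W → V}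

theorem ncDeg_comap (hf : f.Injective) (hG : ∀ s t, G.Adj s t → s ∈ Set.range f) (z : W) :
    ncDeg (G.comap f) z = ncDeg G (f z) :=
  Set.ncard_preimage_of_injective_subset_range hf fun t ht => hG t (f z) (Adj.symm ht)

theorem reachable_comap_iff (hf : f.Injective) (hG : ∀ s t, G.Adj s t → s ∈ Set.range f)
    {p q : W} : (G.comap f).Reachable p q ↔ G.Reachable (f p) (f q) := by
  refine ⟨reachable_map_of_adj f fun s t hst => Adj.reachable hst, fun h => ?_⟩
  have : Nonempty W := ⟨p⟩
  have h1 := reachable_map_of_adj (G' := G.comap f) (Function.invFun f) (fun s t hst => by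
    obtain ⟨s, rfl⟩ := hG s t hst
    obtain ⟨t, rfl⟩ := hG t _ hst.symm
    rw [Function.leftInverse_invFun hf, Function.leftInverse_invFun hf]
    exact Adj.reachable hst) h
  rwa [Function.leftInverse_invFun hf, Function.leftInverse_invFun hf] at h1

theorem mem_side_comap_iff (hf : f.Injective) (hG : ∀ s t, G.Adj s t → s ∈ Set.range f)
    {p q z : W} : z ∈ Side (G.comap f) p q ↔ f z ∈ Side G (f p) (f q) := by
  have h : (G.comap f).deleteEdges {s(p, q)} = (G.deleteEdges {s(f p, f q)}).comap f := by
    ext s t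
    simp [SimpleGraph.deleteEdges_adj, hf.eq_iff]
  unfold Side
  rw [h]
  refine reachable_comap_iff hf fun s t hst => hG s t ?_
  exact (SimpleGraph.deleteEdges_adj.1 hst).1

theorem ConnOn.comap (hf : f.Injective) {S : Set V} (h : ConnOn G S) (hS : S ⊆ Set.range f) :
    ConnOn (G.comap f) (f ⁻¹' S) := by
  obtain ⟨s, hs⟩ := h.1
  obtain ⟨s, rfl⟩ := hS hs
  have : Nonempty W := ⟨s⟩
  refine h.map (Function.invFun f) ⟨s, hs⟩
    (fun z hz => ⟨f z, hz, Function.leftInverse_invFun hf z⟩) ?_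
  intro p hp q hq hpq
  obtain ⟨p, rfl⟩ := hS hp
  obtain ⟨q, rfl⟩ := hS hq
  rw [Function.leftInverse_invFun hf, Function.leftInverse_invFun hf]
  exact Relation.ReflTransGen.single ⟨hpq, hp, hq⟩

theorem C4Free.comap (hf : f.Injective) (h : C4Free G) : C4Free (G.comap f) := by
  rw [c4Free_iff] at h ⊢
  exact fun p q r s h1 h2 h3 h4 hpr => hf (h _ _ _ _ h1 h2 h3 h4 (hf.ne hpr))

end Comap

/-- Deleting `v` and `x` and relabelling the remaining vertices gives a Halin graph. -/
theorem HalinGraph.exists_of_surgery {V W : Type*} [Fintype V] [Fintype W] (H : HalinGraph V)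
    (hfree : C4Free H.graph) {v x y w a b c d : V} {A B : Set V}
    (h : Surgery H.T H.C v x y w a b c d A B) {f : W → V} (hf : f.Injective)
    (hrange : ∀ z, z ∈ Set.range f ↔ z ≠ v ∧ z ≠ x) :
    ∃ H' : HalinGraph W, C4Free H'.graph ∧ ∀ z, IsLeaf H'.T z ↔ IsLeaf H.T (f z) := by
  have hmem : ∀ z, f z ≠ v ∧ f z ≠ x := fun z => (hrange _).1 ⟨z, rfl⟩
  have hT : ∀ s t, (splicedTree H.T v x y w).Adj s t → s ∈ Set.range f := fun s t hst =>
    (hrange s).2 ⟨hst.2.1.1, hst.2.1.2.1⟩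
  have hC : ∀ s t, (splicedCycle H.C x a b c d).Adj s t → s ∈ Set.range f := fun s t hst =>
    (hrange s).2 ⟨fun e => h.leaf_v (e ▸ (h.cycle_adj_isLeaf hst).1), hst.2.1.1⟩
  have hdeg : ∀ z, ncDeg ((splicedTree H.T v x y w).comap f) z = ncDeg H.T (f z) := fun z => by
    rw [ncDeg_comap hf hT, h.ncDeg_splicedTree (hmem z)]
  have hleaf : ∀ z, IsLeaf ((splicedTree H.T v x y w).comap f) z ↔ IsLeaf H.T (f z) := fun z => by
    rw [IsLeaf, hdeg, IsLeaf]
  have hcyc : ∀ z, ncDeg ((splicedCycle H.C x a b c d).comap f) z = ncDeg H.C (f z) := fun z => by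
    rw [ncDeg_comap hf hC, h.ncDeg_splicedCycle (hmem z).2]
  have hsub : ∀ S : Set V, (∀ z ∈ S, IsLeaf H.T z) → S \ {x} ⊆ Set.range f := fun S hS z hz =>
    (hrange z).2 ⟨fun e => h.leaf_v (e ▸ hS z hz.1), hz.2⟩
  have hsupp : ((splicedCycle H.C x a b c d).comap f).support =
      {z | IsLeaf ((splicedTree H.T v x y w).comap f) z} := by
    ext z
    rw [Set.mem_ofPred_eq, hleaf]
    refine ⟨fun ⟨t, ht⟩ => (h.cycle_adj_isLeaf ht).1, fun hz => ?_⟩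
    have h2 : f z ∈ H.C.support := by rw [H.support_C]; exact hz
    have h1 : (((splicedCycle H.C x a b c d).comap f).neighborSet z).ncard ≠ 0 := by
      have := hcyc z
      rw [H.two_regular _ h2] at this
      unfold ncDeg at this
      omega
    exact Set.nonempty_of_ncard_ne_zero h1
  refine ⟨{ T := (splicedTree H.T v x y w).comap f
            C := (splicedCycle H.C x a b c d).comap f
            tree_isTree := ?_
            four_le_card := ?_
            nonleaf_degree := fun z hz => by
              rw [hdeg]
              exact H.nonleaf_degree _ fun h1 => hz ((hleaf z).2 h1)
            support_C := hsupp
            two_regular := fun z hz => ?_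
            cycle_connected := ?_
            planar := fun p q hpq => ?_ }, ?_, hleaf⟩
  · obtain ⟨y', hy'⟩ := (hrange y).2 (h.ne_of_mem h.y_mem)
    have : Nonempty W := ⟨y'⟩
    refine ⟨⟨fun p q => ?_⟩, h.isAcyclic_splicedTree.comap ⟨f, fun h1 => h1⟩ hf⟩
    rw [reachable_comap_iff hf hT]
    exact (h.reachable_splicedTree (hmem p)).symm.trans (h.reachable_splicedTree (hmem q))
  · have hx1 := h.ne_of_mem h.a_mem
    have hab : a ≠ b := fun e => h.disjoint h.a_mem (e ▸ h.b_mem)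
    have had : a ≠ d := fun e => h.disjoint h.a_mem (e ▸ h.d_mem)
    have hcb : c ≠ b := fun e => h.disjoint h.c_mem (e ▸ h.b_mem)
    have hcd : c ≠ d := fun e => h.disjoint h.c_mem (e ▸ h.d_mem)
    classical
    have hcard : ({a, b, c, d} : Finset V).card = 4 := by
      simp [hab, had, hcb.symm, hcd, h.a_ne_c, h.b_ne_d]
    rw [← hcard, ← Finset.card_univ, ← Finset.card_image_of_injective _ hf]
    refine Finset.card_le_card fun z hz => ?_
    have : z ∈ Set.range f := by
      rw [hrange]
      simp only [Finset.mem_insert, Finset.mem_singleton] at hz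
      rcases hz with rfl | rfl | rfl | rfl
      exacts [h.ne_of_mem h.a_mem, h.swap.ne_of_mem h.b_mem, h.ne_of_mem h.c_mem,
        h.swap.ne_of_mem h.d_mem]
    obtain ⟨t, rfl⟩ := this
    simp
  · rw [hsupp] at hz
    rw [hcyc]
    refine H.two_regular _ ?_
    rw [H.support_C]
    exact (hleaf z).1 hz
  · rw [connected_induce_iff_connOn, hsupp]
    have h1 := (connected_induce_iff_connOn _ _).1 H.cycle_connected
    rw [H.support_C] at h1
    have h2 := (h.connOn_of_superset h1 h.leaf_x fun z hz _ => hz).comap hf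
      (hsub _ fun z hz => hz)
    convert h2 using 1
    ext z
    simp [hleaf, (hmem z).2]
  · rw [connected_induce_iff_connOn]
    have h2 := (h.planar_splice (fun p q hpq => H.connOn_side hpq) hpq).comap hf
      (hsub _ fun z hz => hz.1)
    convert h2 using 1
    ext z
    have h3 := mem_side_comap_iff hf hT (p := p) (q := q) (z := z)
    have h4 := hleaf z
    have h5 := (hmem z).2
    simp only [Set.mem_preimage, Set.mem_sdiff, Set.mem_ofPred_eq, Set.mem_singleton_iff]
    unfold Side at h3 ⊢
    simp only [Set.mem_ofPred_eq] at h3 ⊢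
    tauto
  · exact (h.c4Free_splice hfree).comap hf

/-- Let `(u, v, w)` be a path in the characteristic tree of an `n`-vertex `C₄`-free
Halin graph with `v` a semi-branching vertex of degree `3`.  If the bounded face
incident to this path (bounded by an outer-cycle edge `w₁w₂` whose tree path uses
both `uv` and `vw`) has size at least `6`, then there is an `(n-2)`-vertex `C₄`-free
Halin graph with exactly three fewer edges. -/
theorem reduce_degree_three {V : Type*} [Fintype V] (H : HalinGraph V)
    (hfree : C4Free H.graph) (u v w : V) (huv : H.T.Adj u v) (hvw : H.T.Adj v w)
    (huw : u ≠ w) (hsb : SemiBranching H.T v) (hdeg : ncDeg H.T v = 3)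
    (w1 w2 : V) (hC : H.C.Adj w1 w2)
    (hface : ∀ p : H.T.Walk w1 w2, p.IsPath → s(u, v) ∈ p.edges ∧ s(v, w) ∈ p.edges)
    (hsize : 6 ≤ H.T.dist w1 w2 + 1) :
    ∃ H' : HalinGraph (Fin (Fintype.card V - 2)),
      C4Free H'.graph ∧ eCount H.graph = eCount H'.graph + 3 := by
  classical
  obtain ⟨x, y, w, a, b, c, d, A, B, h⟩ := H.exists_surgery hfree hsb hdeg
  have hcard : Fintype.card {z // z ≠ v ∧ z ≠ x} = Fintype.card V - 2 := by
    rw [Fintype.card_subtype, ← Finset.card_pair h.adj_vx.ne, ← Finset.card_compl]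
    congr 1
    ext z
    simp
  let e := (Fintype.equivFinOfCardEq hcard).symm
  have hf : Function.Injective fun i => (e i).1 := Subtype.val_injective.comp e.injective
  have hrange : ∀ z, z ∈ Set.range (fun i => (e i).1) ↔ z ≠ v ∧ z ≠ x := fun z => by
    refine ⟨?_, fun hz => ⟨e.symm ⟨z, hz⟩, by simp⟩⟩
    rintro ⟨i, rfl⟩
    exact (e i).2
  obtain ⟨H', hfree', hleaf⟩ := H.exists_of_surgery hfree h hf hrange
  refine ⟨H', hfree', ?_⟩
  have h1 := H.eCount_graph
  have h2 := H'.eCount_graph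
  have h3 : {z | IsLeaf H'.T z}.ncard + 1 = {z | IsLeaf H.T z}.ncard := by
    rw [← Set.ncard_sdiff_singleton_add_one (show x ∈ {z | IsLeaf H.T z} from h.leaf_x)
      (Set.toFinite _)]
    congr 1
    rw [← Set.ncard_preimage_of_injective_subset_range hf]
    · congr 1
      ext z
      simp [hleaf, (e z).2.2]
    · exact fun z hz => (hrange z).2 ⟨fun he => h.leaf_v (he ▸ hz.1), hz.2⟩
  have h4 := H.four_le_card
  rw [Fintype.card_fin] at h2
  omega
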